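/- arXiv:2306.05261 — 3 statements merged into one kernel-verified Lean document; each statement's English description precedes it below -/
import Mathlib

section
/- Let G be a group of isometries of ℝ^n that tiles ℝ^n with an n-dimensional convex polytope Π. Then every orbit of G is locally finite: for every bounded set B ⊆ ℝ^n and every x ∈ ℝ^n, the set B ∩ G(x) is finite, where G(x) = {φx : φ ∈ G} is the orbit of x. -/
open Set Metric MeasureTheory Filter

noncomputable section

abbrev Euc (n : ℕ) : Type := EuclideanSpace ℝ (Fin n)

/-- `P` is an `n`-dimensional convex polytope in `ℝⁿ`: the convex hull of a finite set
whose affine span is all of the space. -/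
def IsConvexPolytope {n : ℕ} (P : Set (Euc n)) : Prop :=
  ∃ V : Finset (Euc n), P = convexHull ℝ (V : Set (Euc n)) ∧ affineSpan ℝ (V : Set (Euc n)) = ⊤

/-- The group of isometries `G` tiles `ℝⁿ` with the set `P`. -/
def Tiles {n : ℕ} (G : Subgroup (Euc n ≃ᵢ Euc n)) (P : Set (Euc n)) : Prop :=
  (⋃ φ ∈ G, ⇑φ '' P) = Set.univ ∧
  ∀ φ ∈ G, ∀ ψ ∈ G, φ ≠ ψ → (⇑φ '' P ∩ ⇑ψ '' P) ⊆ frontier (⇑φ '' P)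

/-- A function on `ℝⁿ` is `G`-invariant if `f ∘ φ = f` for all `φ ∈ G`. -/
def GInvariant {n : ℕ} {X : Type*} (G : Subgroup (Euc n ≃ᵢ Euc n)) (f : Euc n → X) : Prop :=
  ∀ φ ∈ G, ∀ x, f (φ x) = f x

/-- Interior points of a tile have uniformly separated images under distinct elements of the
tiling group. -/
theorem Tiles.le_dist_of_ball_subset {n : ℕ} {G : Subgroup (Euc n ≃ᵢ Euc n)} {P : Set (Euc n)}
    (hT : Tiles G P) {p : Euc n} {r : ℝ} (hr : 0 < r) (hp : ball p r ⊆ P)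
    {φ ψ : Euc n ≃ᵢ Euc n} (hφ : φ ∈ G) (hψ : ψ ∈ G) (hne : φ ≠ ψ) :
    r ≤ dist (φ p) (ψ p) := by
  by_contra! hlt
  have hball : ball (φ p) r ⊆ φ '' P := by
    rw [← φ.image_ball]
    exact image_mono hp
  have hmem : ψ p ∈ ball (φ p) r := by rwa [mem_ball']
  have hfrontier := hT.2 φ hφ ψ hψ hne ⟨hball hmem, mem_image_of_mem ψ (hp (mem_ball_self hr))⟩
  exact hfrontier.2 (interior_maximal hball isOpen_ball hmem)

/-- If a family of isometries of a proper space separates the images of some point `p` uniformly,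
then only finitely many members send a given point `x` into a given bounded set. -/
theorem finite_setOf_apply_mem_of_pairwise_le_dist {ι α : Type*} [MetricSpace α] [ProperSpace α]
    {f : ι → α → α} (hf : ∀ i, Isometry (f i)) {p : α} {r : ℝ} (hr : 0 < r)
    (hsep : Pairwise fun i j => r ≤ dist (f i p) (f j p))
    {B : Set α} (hB : Bornology.IsBounded B) (x : α) : {i | f i x ∈ B}.Finite := by
  let _ : TopologicalSpace ι := ⊥
  have _ : DiscreteTopology ι := ⟨rfl⟩
  have hemb := isClosedEmbedding_of_pairwise_le_dist hr hsep
  have hcompact : IsCompact (cthickening (dist p x) B) :=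
    isCompact_of_isClosed_isBounded isClosed_cthickening hB.cthickening
  refine (hemb.isCompact_preimage hcompact).finite_of_discrete.subset fun i hi => ?_
  exact mem_cthickening_of_dist_le _ _ _ _ hi ((hf i).dist_eq p x).le

/-- Orbits of a crystallographic group are locally finite: every bounded set contains only
finitely many points of each orbit. -/
theorem orbit_locally_finite (n : ℕ) (G : Subgroup (Euc n ≃ᵢ Euc n)) (P : Set (Euc n))
    (hP : IsConvexPolytope P) (hT : Tiles G P) :
    ∀ B : Set (Euc n), Bornology.IsBounded B → ∀ x : Euc n,
      (B ∩ {y | ∃ φ ∈ G, y = φ x}).Finite := by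
  intro B hB x
  obtain ⟨V, rfl, hV⟩ := hP
  obtain ⟨p, hp⟩ := interior_convexHull_nonempty_iff_affineSpan_eq_top.mpr hV
  obtain ⟨r, hr, hball⟩ := Metric.mem_nhds_iff.mp (mem_interior_iff_mem_nhds.mp hp)
  have hfin : {φ : G | (φ : Euc n ≃ᵢ Euc n) x ∈ B}.Finite :=
    finite_setOf_apply_mem_of_pairwise_le_dist (f := fun φ : G => ⇑(φ : Euc n ≃ᵢ Euc n))
      (fun φ => φ.1.isometry) hr
      (fun φ ψ hne => hT.le_dist_of_ball_subset hr hball φ.2 ψ.2 (Subtype.coe_injective.ne hne))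
      hB x
  refine (hfin.image fun φ : G => (φ : Euc n ≃ᵢ Euc n) x).subset ?_
  rintro _ ⟨hy, φ, hφ, rfl⟩
  exact ⟨⟨φ, hφ⟩, hy, rfl⟩
end
end

section
/- Let G be a group of isometries of ℝ^n that tiles ℝ^n with an n-dimensional convex polytope Π, let Π̃ ⊆ Π be a transversal, and let p : ℝ^n → Π be the associated projector. If X is a topological space and h : Π → X is continuous and satisfies the periodic boundary condition, then h∘p : ℝ^n → X is continuous and G-invariant. Consequently, a function f : ℝ^n → ℝ is continuous and G-invariant if and only if f = h∘p for some continuous h : Π → ℝ satisfying the periodic boundary condition. -/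
open Set Metric MeasureTheory Filter

noncomputable section

universe u

/-- `h` satisfies the periodic boundary condition on `P`. -/
def SatisfiesPBC {n : ℕ} {X : Type*} (G : Subgroup (Euc n ≃ᵢ Euc n)) (P : Set (Euc n))
    (h : Euc n → X) : Prop :=
  ∀ x ∈ P, ∀ φ ∈ G, φ ≠ 1 → φ x ∈ P → h (φ x) = h x

/-- `T` is a transversal for `G`: it contains exactly one point of each orbit. -/
def IsTransversal {n : ℕ} (G : Subgroup (Euc n ≃ᵢ Euc n)) (T : Set (Euc n)) : Prop :=
  ∀ x : Euc n, ∃! y, y ∈ T ∧ ∃ φ ∈ G, y = φ x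

/-- Distinct tiles have centres at distance at least `r`, if `P` contains a ball of radius `r`. -/
lemma Tiles.le_dist {n : ℕ} {G : Subgroup (Euc n ≃ᵢ Euc n)} {P : Set (Euc n)} (hT : Tiles G P)
    {c : Euc n} {r : ℝ} (hr : 0 < r) (hc : ball c r ⊆ P) {φ ψ : G} (hne : φ ≠ ψ) :
    r ≤ dist (φ.1 c) (ψ.1 c) := by
  by_contra! hlt
  have hcP : c ∈ P := hc (mem_ball_self hr)
  have hball : ball (φ.1 c) r ⊆ φ.1 '' P := by
    rw [← φ.1.image_ball]
    exact image_mono hc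
  have hmem : ψ.1 c ∈ ball (φ.1 c) r := by rwa [mem_ball']
  have hfr := hT.2 φ.1 φ.2 ψ.1 ψ.2 (fun h => hne (Subtype.ext h))
    ⟨hball hmem, mem_image_of_mem _ hcP⟩
  exact hfr.2 (interior_maximal hball isOpen_ball hmem)

/-- A tiling by a bounded set with nonempty interior is locally finite. -/
lemma Tiles.locallyFinite {n : ℕ} {G : Subgroup (Euc n ≃ᵢ Euc n)} {P : Set (Euc n)}
    (hT : Tiles G P) (hb : Bornology.IsBounded P) (hi : (interior P).Nonempty) :
    LocallyFinite fun φ : G => φ.1 '' P := by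
  obtain ⟨c, hc⟩ := hi
  obtain ⟨r, hr, hcr⟩ := Metric.isOpen_iff.1 isOpen_interior c hc
  replace hcr := hcr.trans interior_subset
  obtain ⟨D, hD⟩ := Metric.isBounded_iff.1 hb
  intro x
  refine ⟨ball x 1, ball_mem_nhds x one_pos, ?_⟩
  obtain ⟨t, ht, hcov⟩ := Metric.totallyBounded_iff.1
    (isCompact_closedBall x (D + 1)).totallyBounded (r / 2) (half_pos hr)
  refine (ht.biUnion (t := fun y => {φ : G | φ.1 c ∈ ball y (r / 2)})
    fun y _ => Set.Subsingleton.finite ?_).subset ?_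
  · intro φ hφ ψ hψ
    by_contra hne
    have h₁ := hT.le_dist hr hcr hne
    have h₂ := dist_triangle_right (φ.1 c) (ψ.1 c) y
    simp only [mem_ofPred_eq, mem_ball] at hφ hψ
    linarith
  · rintro φ ⟨_, ⟨y, hy, rfl⟩, hyx⟩
    have hφc : φ.1 c ∈ closedBall x (D + 1) := by
      have h₁ := dist_triangle (φ.1 c) (φ.1 y) x
      have h₂ := hD (interior_subset hc) hy
      rw [← φ.1.dist_eq] at h₂
      rw [mem_ball] at hyx
      rw [mem_closedBall]
      linarith
    simpa using hcov hφc

lemma IsConvexPolytope.isCompact {n : ℕ} {P : Set (Euc n)} (hP : IsConvexPolytope P) :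
    IsCompact P := by
  obtain ⟨V, rfl, -⟩ := hP
  exact V.finite_toSet.isCompact_convexHull (𝕜 := ℝ)

lemma IsConvexPolytope.interior_nonempty {n : ℕ} {P : Set (Euc n)} (hP : IsConvexPolytope P) :
    (interior P).Nonempty := by
  obtain ⟨V, rfl, hV⟩ := hP
  exact interior_convexHull_nonempty_iff_affineSpan_eq_top.2 hV

/-- A projector onto a transversal is constant on orbits. -/
lemma IsTransversal.gInvariant {n : ℕ} {G : Subgroup (Euc n ≃ᵢ Euc n)} {T : Set (Euc n)}
    (htrans : IsTransversal G T) {p : Euc n → Euc n}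
    (hp : ∀ x : Euc n, p x ∈ T ∧ ∃ φ ∈ G, p x = φ x) : GInvariant G p := by
  intro φ hφ x
  obtain ⟨hmem, ψ, hψ, h⟩ := hp (φ x)
  exact (htrans x).unique ⟨hmem, ψ * φ, G.mul_mem hψ hφ, h⟩ (hp x)

/-- On each tile, the composition of a periodic function with a projector is the translate of
the function by the group element carrying the tile to `P`. -/
lemma SatisfiesPBC.comp_projector_apply {n : ℕ} {X : Type*} {G : Subgroup (Euc n ≃ᵢ Euc n)}
    {P : Set (Euc n)} {h : Euc n → X} (hh : SatisfiesPBC G P h) {p : Euc n → Euc n}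
    (hp : ∀ x : Euc n, p x ∈ P ∧ ∃ φ ∈ G, p x = φ x) {φ : Euc n ≃ᵢ Euc n} (hφ : φ ∈ G)
    {y : Euc n} (hy : y ∈ P) : h (p (φ y)) = h y := by
  obtain ⟨hmem, ψ, hψ, he⟩ := hp (φ y)
  rw [he] at hmem ⊢
  by_cases h1 : ψ * φ = 1
  · exact congrArg h (DFunLike.congr_fun h1 y)
  · exact hh y hy (ψ * φ) (G.mul_mem hψ hφ) h1 hmem

lemma SatisfiesPBC.continuous_comp_projector {n : ℕ} {X : Type*} [TopologicalSpace X]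
    {G : Subgroup (Euc n ≃ᵢ Euc n)} {P : Set (Euc n)} (hP : IsConvexPolytope P) (hT : Tiles G P)
    {h : Euc n → X} (hh : SatisfiesPBC G P h) (hc : ContinuousOn h P) {p : Euc n → Euc n}
    (hp : ∀ x : Euc n, p x ∈ P ∧ ∃ φ ∈ G, p x = φ x) : Continuous (h ∘ p) := by
  refine (hT.locallyFinite hP.isCompact.isBounded hP.interior_nonempty).continuous
    ?_ (fun φ => (hP.isCompact.image φ.1.continuous).isClosed) fun φ => ?_
  · rw [← hT.1, iUnion_subtype]
  · have hmaps : MapsTo φ.1.symm (φ.1 '' P) P := by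
      rintro _ ⟨y, hy, rfl⟩
      simpa using hy
    refine (hc.comp φ.1.symm.continuous.continuousOn hmaps).congr ?_
    rintro _ ⟨y, hy, rfl⟩
    simpa using hh.comp_projector_apply hp φ.2 hy

/-- Composing a continuous function satisfying the periodic boundary condition with the
projector yields a continuous `G`-invariant function, and all continuous `G`-invariant
functions arise this way. -/
theorem projector_composition (n : ℕ) (G : Subgroup (Euc n ≃ᵢ Euc n)) (P T : Set (Euc n))
    (hP : IsConvexPolytope P) (hT : Tiles G P) (hTP : T ⊆ P) (htrans : IsTransversal G T)
    (p : Euc n → Euc n) (hp : ∀ x : Euc n, p x ∈ T ∧ ∃ φ ∈ G, p x = φ x) :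
    (∀ (X : Type u) [TopologicalSpace X], ∀ h : Euc n → X,
      ContinuousOn h P → SatisfiesPBC G P h →
        Continuous (h ∘ p) ∧ GInvariant G (h ∘ p)) ∧
    (∀ f : Euc n → ℝ, (Continuous f ∧ GInvariant G f) ↔
      ∃ h : Euc n → ℝ, ContinuousOn h P ∧ SatisfiesPBC G P h ∧ f = h ∘ p) := by
  have hpP : ∀ x : Euc n, p x ∈ P ∧ ∃ φ ∈ G, p x = φ x := fun x => ⟨hTP (hp x).1, (hp x).2⟩
  have hinv := htrans.gInvariant hp
  refine ⟨fun X _ h hc hh => ⟨hh.continuous_comp_projector hP hT hc hpP,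
    fun φ hφ x => congrArg h (hinv φ hφ x)⟩, fun f => ⟨?_, ?_⟩⟩
  · rintro ⟨hf, hG⟩
    refine ⟨f, hf.continuousOn, fun x _ φ hφ _ _ => hG φ hφ x, funext fun x => ?_⟩
    obtain ⟨-, φ, hφ, h⟩ := hp x
    rw [Function.comp_apply, h, hG φ hφ x]
  · rintro ⟨h, hc, hh, rfl⟩
    exact ⟨hh.continuous_comp_projector hP hT hc hpP, fun φ hφ x => congrArg h (hinv φ hφ x)⟩
end
end

section
/- Let G be a group of isometries of ℝ^n that tiles ℝ^n with an n-dimensional convex polytope Π, and let μ denote (n−1)-dimensional Hausdorff measure on ∂Π. Let N : ∂Π → ℝ^n be a measurable map such that for μ-almost every x ∈ ∂Π, N(x) is a unit vector with Π ⊆ {y ∈ ℝ^n : ⟨y − x, N(x)⟩ ≤ 0} (an outward unit normal field). Let F : Π → ℝ^n be a vector field such that x ↦ ⟨F(x), N(x)⟩ is μ-integrable on ∂Π and such that F(φx) = A_φF(x) whenever φ ∈ G and both x and φx lie in Π. Then ∫_{∂Π} ⟨F(x), N(x)⟩ dμ(x) = 0. -/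
open Set Metric MeasureTheory Filter

noncomputable section

open scoped RealInnerProductSpace

/-- `u` is an outward unit normal vector of `P` at `x`. -/
def IsUnitNormal {n : ℕ} (P : Set (Euc n)) (x u : Euc n) : Prop :=
  ‖u‖ = 1 ∧ ∀ y ∈ P, ⟪y - x, u⟫ ≤ 0

theorem hausdorffMeasure_convexHull_eq_zero {n : ℕ} {W : Set (Euc n)}
    (hW : Module.finrank ℝ (vectorSpan ℝ W) + 2 ≤ n) :
    μH[(n : ℝ) - 1] (convexHull ℝ W) = 0 := by
  rcases W.eq_empty_or_nonempty with rfl | ⟨w, hw⟩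
  · simp
  have hsub : convexHull ℝ W ⊆ (fun v : vectorSpan ℝ W => (v : Euc n) + w) '' univ := by
    intro y hy
    have hy' : y ∈ affineSpan ℝ W := convexHull_subset_affineSpan W hy
    have h1 : y -ᵥ w ∈ (affineSpan ℝ W).direction :=
      AffineSubspace.vsub_mem_direction hy' (subset_affineSpan ℝ W hw)
    rw [direction_affineSpan] at h1
    exact ⟨⟨y -ᵥ w, h1⟩, mem_univ _, by simp⟩
  have hiso : Isometry (fun v : vectorSpan ℝ W => (v : Euc n) + w) :=
    Isometry.of_dist_eq fun a b => by simp [Subtype.dist_eq]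
  refine measure_mono_null hsub ?_
  have h2 : ((n : ℝ) - 1) = (((n - 1 : ℕ) : NNReal) : ℝ) := by
    rw [NNReal.coe_natCast, Nat.cast_sub (by omega), Nat.cast_one]
  rw [h2]
  apply hausdorffMeasure_of_dimH_lt
  rw [hiso.dimH_image, Real.dimH_univ_eq_finrank]
  have : Module.finrank ℝ (vectorSpan ℝ W) < n - 1 := by omega
  exact_mod_cast this

theorem finrank_vectorSpan_add_two_le {n : ℕ} {W : Set (Euc n)} {x u v : Euc n}
    (hu : ‖u‖ = 1) (hv : ‖v‖ = 1) (huv : u ≠ v) (huv' : u ≠ -v)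
    (hW : ∀ y ∈ W, ⟪y - x, u⟫ = 0 ∧ ⟪y - x, v⟫ = 0) :
    Module.finrank ℝ (vectorSpan ℝ W) + 2 ≤ n := by
  have hli : LinearIndependent ℝ ![u, v] := by
    have hu0 : u ≠ 0 := by
      rintro rfl
      simp at hu
    rw [LinearIndependent.pair_iff' hu0]
    intro a ha
    have h1 : |a| = 1 := by
      have := congrArg norm ha
      rwa [norm_smul, hu, hv, mul_one, Real.norm_eq_abs] at this
    rcases (abs_eq zero_le_one).1 h1 with rfl | rfl
    · exact huv (by simpa using ha)
    · exact huv' (by rw [← ha]; simp)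
  have hle : vectorSpan ℝ W ≤ (Submodule.span ℝ (range ![u, v]))ᗮ := by
    rw [vectorSpan_def, Submodule.span_le]
    rintro _ ⟨p, hp, q, hq, rfl⟩
    have hpq : p -ᵥ q = (p - x) - (q - x) := by simp
    refine (Submodule.mem_orthogonal' _ _).2 fun z hz => ?_
    rw [Matrix.range_cons, Matrix.range_cons, Matrix.range_empty, union_empty,
      singleton_union, Submodule.mem_span_pair] at hz
    obtain ⟨a, b, rfl⟩ := hz
    simp only [hpq, inner_add_right, inner_smul_right, inner_sub_left (p - x), hW p hp, hW q hq]
    simp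
  have h1 := Submodule.finrank_mono hle
  have h2 := Submodule.finrank_add_finrank_orthogonal (Submodule.span ℝ (range ![u, v]))
  rw [finrank_span_eq_card hli, finrank_euclideanSpace] at h2
  simp only [Fintype.card_fin] at h2
  omega

namespace IsConvexPolytope

variable {n : ℕ} {P : Set (Euc n)}

theorem isCompact_s13 (hP : IsConvexPolytope P) : IsCompact P := by
  obtain ⟨V, rfl, -⟩ := hP
  exact V.finite_toSet.isCompact_convexHull ℝ

theorem convex (hP : IsConvexPolytope P) : Convex ℝ P := by
  obtain ⟨V, rfl, -⟩ := hP
  exact convex_convexHull ℝ _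

theorem interior_nonempty_s13 (hP : IsConvexPolytope P) : (interior P).Nonempty := by
  obtain ⟨V, rfl, h⟩ := hP
  exact interior_convexHull_nonempty_iff_affineSpan_eq_top.2 h

/-- Opposite unit vectors cannot both be outward normals of a full-dimensional polytope. -/
theorem ne_neg_of_isUnitNormal (hP : IsConvexPolytope P) {x u v : Euc n}
    (hu : IsUnitNormal P x u) (hv : IsUnitNormal P x v) : u ≠ -v := by
  rintro rfl
  have h0 : ∀ y ∈ P, ⟪y - x, v⟫ = 0 := fun y hy =>
    le_antisymm (hv.2 y hy) (by simpa [inner_neg_right] using hu.2 y hy)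
  obtain ⟨c, hc⟩ := hP.interior_nonempty_s13
  obtain ⟨r, hr, hball⟩ := Metric.isOpen_iff.1 isOpen_interior c hc
  have hmem : c + (r / 2) • v ∈ P := interior_subset <| hball <| by
    rw [mem_ball, dist_self_add_left, norm_smul, hv.1, Real.norm_eq_abs, abs_of_pos (by positivity)]
    linarith
  have h1 := h0 _ hmem
  rw [add_sub_right_comm, inner_add_left, h0 c (interior_subset hc), inner_smul_left,
    real_inner_self_eq_norm_sq, hv.1] at h1
  simp at h1
  exact hr.ne' h1

/-- Almost every point has at most one outward unit normal. -/
theorem ae_isUnitNormal_unique (hP : IsConvexPolytope P) :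
    ∀ᵐ x ∂(μH[(n : ℝ) - 1] : Measure (Euc n)), x ∈ P →
      ∀ u v, IsUnitNormal P x u → IsUnitNormal P x v → u = v := by
  classical
  obtain ⟨V, hV, -⟩ := id hP
  have hnull : μH[(n : ℝ) - 1] (⋃ W ∈ V.powerset.filter
      (fun W : Finset (Euc n) => Module.finrank ℝ (vectorSpan ℝ (W : Set (Euc n))) + 2 ≤ n),
        convexHull ℝ (W : Set (Euc n))) = 0 := by
    refine (measure_biUnion_null_iff (Finset.countable_toSet _)).2 fun W hW => ?_
    exact hausdorffMeasure_convexHull_eq_zero (Finset.mem_filter.1 hW).2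
  filter_upwards [compl_mem_ae_iff.2 hnull] with x hx hxP u v hu hv
  by_contra huv
  apply hx
  obtain ⟨w, hw0, hw1, hwx⟩ : ∃ w : Euc n → ℝ, (∀ y ∈ V, 0 ≤ w y) ∧ ∑ y ∈ V, w y = 1 ∧
      V.centerMass w id = x := by
    rw [hV, Finset.convexHull_eq] at hxP
    exact hxP
  have hVP : ∀ y ∈ V, y ∈ P := fun y hy => hV ▸ subset_convexHull ℝ _ hy
  have key : ∀ u, IsUnitNormal P x u → ∀ y ∈ V, w y ≠ 0 → ⟪y - x, u⟫ = 0 := by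
    intro u hu
    have hsum : ∑ y ∈ V, w y * ⟪y - x, u⟫ = 0 := by
      rw [Finset.centerMass_eq_of_sum_1 _ _ hw1] at hwx
      have : ∑ y ∈ V, w y • (y - x) = 0 := by
        simp only [smul_sub, Finset.sum_sub_distrib, ← Finset.sum_smul, hw1, one_smul]
        simpa [sub_eq_zero] using hwx
      rw [← inner_zero_left (𝕜 := ℝ) u, ← this, sum_inner]
      exact Finset.sum_congr rfl fun y _ => by rw [real_inner_smul_left]
    have h3 := (Finset.sum_eq_zero_iff_of_nonpos fun y hy =>
      mul_nonpos_of_nonneg_of_nonpos (hw0 y hy) (hu.2 y (hVP y hy))).1 hsum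
    exact fun y hy hne => (mul_eq_zero.1 (h3 y hy)).resolve_left hne
  refine mem_biUnion (x := V.filter (fun y => w y ≠ 0)) ?_ ?_
  · refine Finset.mem_filter.2 ⟨Finset.mem_powerset.2 (Finset.filter_subset _ _),
      finrank_vectorSpan_add_two_le (x := x) hu.1 hv.1 huv
      (hP.ne_neg_of_isUnitNormal hu hv) ?_⟩
    intro y hyW
    obtain ⟨hy, hwy⟩ := Finset.mem_filter.1 hyW
    exact ⟨key u hu y hy hwy, key v hv y hy hwy⟩
  · rw [← hwx, ← Finset.centerMass_filter_ne_zero]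
    refine Finset.centerMass_mem_convexHull _ (fun y hy => hw0 y (Finset.mem_filter.1 hy).1) ?_
      fun y hy => by simpa using hy
    rw [Finset.sum_filter_ne_zero, hw1]
    exact one_pos

end IsConvexPolytope

namespace Tiles

variable {n : ℕ} {G : Subgroup (Euc n ≃ᵢ Euc n)} {P : Set (Euc n)}

theorem mem_frontier (hT : Tiles G P) {φ : Euc n ≃ᵢ Euc n} (hφ : φ ∈ G) (h1 : φ ≠ 1)
    {x : Euc n} (hx : x ∈ P) (hφx : φ x ∈ P) : x ∈ frontier P := by
  have := hT.2 1 G.one_mem φ⁻¹ (G.inv_mem hφ) (by simpa [eq_comm] using h1)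
  have h2 : x ∈ ⇑(1 : Euc n ≃ᵢ Euc n) '' P ∩ ⇑φ⁻¹ '' P :=
    ⟨⟨x, hx, rfl⟩, ⟨φ x, hφx, IsometryEquiv.inv_apply_self φ x⟩⟩
  simpa [IsometryEquiv.coe_one] using this h2

/-- A bounded set meets only finitely many tiles. -/
theorem finite_meeting (hT : Tiles G P) (hPc : IsCompact P) (hPi : (interior P).Nonempty)
    {K : Set (Euc n)} (hK : Bornology.IsBounded K) :
    {φ | φ ∈ G ∧ ∃ x ∈ K, φ x ∈ P}.Finite := by
  obtain ⟨c, hc⟩ := hPi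
  obtain ⟨r, hr, hball⟩ := Metric.isOpen_iff.1 isOpen_interior c hc
  set S := {φ : Euc n ≃ᵢ Euc n | φ ∈ G ∧ ∃ x ∈ K, φ x ∈ P} with hS
  have hsep : ∀ φ ∈ S, ∀ ψ ∈ S, φ ≠ ψ → r ≤ dist (φ⁻¹ c) (ψ⁻¹ c) := by
    intro φ hφ ψ hψ hne
    by_contra! hlt
    have hmem : φ (ψ⁻¹ c) ∈ interior P := hball <| by
      have := φ.dist_eq (ψ⁻¹ c) (φ⁻¹ c)
      rw [IsometryEquiv.apply_inv_self] at this
      rw [mem_ball, this, dist_comm]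
      exact hlt
    have hfr := hT.mem_frontier (φ := ψ * φ⁻¹) (G.mul_mem hψ.1 (G.inv_mem hφ.1))
      (fun h => hne (mul_inv_eq_one.1 h).symm) (x := φ (ψ⁻¹ c)) (interior_subset hmem)
      (by simpa [IsometryEquiv.mul_apply] using interior_subset hc)
    exact hfr.2 hmem
  obtain ⟨R, hR⟩ := hK.subset_closedBall c
  obtain ⟨R', hR'⟩ := hPc.isBounded.subset_closedBall c
  have hbd : ∀ φ ∈ S, φ⁻¹ c ∈ closedBall c (R' + R) := by
    rintro φ ⟨-, x, hx, hφx⟩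
    have h1 : dist (φ⁻¹ c) x = dist c (φ x) := by
      rw [← φ.dist_eq, IsometryEquiv.apply_inv_self]
    have h2 := hR hx
    have h3 := hR' hφx
    rw [mem_closedBall] at h2 h3 ⊢
    calc dist (φ⁻¹ c) c ≤ dist (φ⁻¹ c) x + dist x c := dist_triangle _ _ _
      _ ≤ R' + R := by rw [h1, dist_comm]; gcongr
  by_contra hinf
  have hinf : S.Infinite := hinf
  obtain ⟨t, htfin, htcov⟩ := Metric.totallyBounded_iff.1
    (isCompact_closedBall c (R' + R)).totallyBounded (r / 2) (by positivity)
  have hex : ∀ φ ∈ S, ∃ y ∈ t, dist (φ⁻¹ c) y < r / 2 := by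
    intro φ hφ
    simpa using htcov (hbd φ hφ)
  choose! g hgt hgd using hex
  obtain ⟨φ, hφ, ψ, hψ, hne, heq⟩ := hinf.exists_ne_map_eq_of_mapsTo (f := g) hgt htfin
  have h1 := hsep φ hφ ψ hψ hne
  have h2 := hgd φ hφ
  have h3 := hgd ψ hψ
  rw [← heq] at h3
  have h4 := dist_triangle_right (φ⁻¹ c) (ψ⁻¹ c) (g φ)
  linarith

/-- Every boundary point of a tile lies in a second tile. -/
theorem exists_ne_one_mem (hT : Tiles G P) (hPc : IsCompact P) (hPi : (interior P).Nonempty)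
    {x : Euc n} (hx : x ∈ frontier P) : ∃ φ ∈ G, φ ≠ 1 ∧ φ x ∈ P := by
  by_contra! h
  have hfin := hT.finite_meeting hPc hPi (isBounded_ball (x := x) (r := 1))
  set S := {φ : Euc n ≃ᵢ Euc n | φ ∈ G ∧ ∃ y ∈ ball x 1, φ y ∈ P}
  have hclosed : IsClosed (⋃ φ ∈ S \ {1}, ⇑φ ⁻¹' P) :=
    hfin.sdiff.isClosed_biUnion fun φ _ => hPc.isClosed.preimage φ.continuous
  have hxn : x ∉ ⋃ φ ∈ S \ {1}, ⇑φ ⁻¹' P := by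
    simp only [mem_iUnion, not_exists]
    exact fun φ hφ hφx => h φ hφ.1.1 hφ.2 hφx
  refine hx.2 (mem_interior_iff_mem_nhds.2 ?_)
  filter_upwards [ball_mem_nhds x one_pos, hclosed.isOpen_compl.mem_nhds hxn] with y hy1 hy2
  have : y ∈ ⋃ φ ∈ G, ⇑φ '' P := hT.1 ▸ mem_univ y
  simp only [mem_iUnion] at this
  obtain ⟨φ, hφ, z, hz, rfl⟩ := this
  by_cases h1 : φ = 1
  · simpa [h1] using hz
  refine absurd ?_ hy2
  refine mem_biUnion (x := φ⁻¹) ⟨⟨G.inv_mem hφ, φ z, hy1, ?_⟩, ?_⟩ ?_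
  · simpa using hz
  · simpa using h1
  · simpa using hz

/-- Two tiles are separated by a hyperplane through any common point. -/
theorem exists_separating_normal (hT : Tiles G P) (hPconv : Convex ℝ P)
    (hPi : (interior P).Nonempty) {φ : Euc n ≃ᵢ Euc n} (hφ : φ ∈ G) (h1 : φ ≠ 1)
    {x : Euc n} (hx : x ∈ P) (hφx : φ x ∈ P) :
    ∃ u, IsUnitNormal P (φ x) u ∧ ∀ y ∈ P, 0 ≤ ⟪φ y - φ x, u⟫ := by
  have hconv : Convex ℝ (⇑φ '' P) := by
    have h := hPconv.affine_image φ.toRealAffineIsometryEquiv.toAffineEquiv.toAffineMap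
    simpa using h
  have hdisj : Disjoint (interior P) (⇑φ '' P) := by
    rw [Set.disjoint_left]
    rintro _ hy ⟨z, hz, rfl⟩
    have := hT.mem_frontier (G.inv_mem hφ) (by simpa using h1) (interior_subset hy)
      (by simpa using hz)
    exact this.2 hy
  obtain ⟨f, s, hf1, hf2⟩ :=
    geometric_hahn_banach_open hPconv.interior isOpen_interior hconv hdisj
  have hfP : ∀ y ∈ P, f y ≤ s := by
    have hcl : IsClosed {y | f y ≤ s} := isClosed_le f.continuous continuous_const
    have hsub := closure_minimal (fun y hy => (hf1 y hy).le : interior P ⊆ {y | f y ≤ s}) hcl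
    rw [hPconv.closure_interior_eq_closure_of_nonempty_interior hPi] at hsub
    exact fun y hy => hsub (subset_closure hy)
  have hfx : f (φ x) = s := le_antisymm (hfP _ hφx) (hf2 _ ⟨x, hx, rfl⟩)
  set v := (InnerProductSpace.toDual ℝ (Euc n)).symm f with hv
  have hinner : ∀ y, ⟪y, v⟫ = f y := fun y => by
    rw [real_inner_comm, hv, InnerProductSpace.toDual_symm_apply]
  have hv0 : ‖v‖ ≠ 0 := by
    rw [norm_ne_zero_iff]
    intro h0
    obtain ⟨c, hc⟩ := hPi
    have h2 := hf1 c hc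
    rw [← hfx, ← hinner, ← hinner, h0] at h2
    simp at h2
  have hpos : 0 < ‖v‖⁻¹ := inv_pos.2 (lt_of_le_of_ne (norm_nonneg v) hv0.symm)
  refine ⟨‖v‖⁻¹ • v, ⟨by rw [norm_smul, norm_inv, norm_norm, inv_mul_cancel₀ hv0], ?_⟩, ?_⟩
  · intro y hy
    rw [real_inner_smul_right, inner_sub_left, hinner, hinner, hfx]
    exact mul_nonpos_of_nonneg_of_nonpos hpos.le (sub_nonpos.2 (hfP y hy))
  · intro y hy
    rw [real_inner_smul_right, inner_sub_left, hinner, hinner, hfx]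
    exact mul_nonneg hpos.le (sub_nonneg.2 (hf2 _ ⟨y, hy, rfl⟩))

end Tiles

/-- The flux property: if the vector field `F` on `Π` transforms on the boundary like a
gradient field (`F(φ x) = A_φ F(x)` whenever `x, φ x ∈ Π`), and its flux through `∂Π` is
integrable with respect to `(n-1)`-dimensional Hausdorff measure, then the total flux of
`F` through `∂Π` vanishes. -/
theorem flux_through_boundary (n : ℕ) (G : Subgroup (Euc n ≃ᵢ Euc n)) (P : Set (Euc n))
    (hP : IsConvexPolytope P) (hT : Tiles G P)
    (A : (Euc n ≃ᵢ Euc n) → (Euc n ≃ₗᵢ[ℝ] Euc n))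
    (hA : ∀ φ ∈ G, ∀ x : Euc n, φ x = A φ x + φ 0)
    (N : Euc n → Euc n) (hNmeas : Measurable N)
    (hN : ∀ᵐ x ∂(μH[(n : ℝ) - 1].restrict (frontier P)),
      ‖N x‖ = 1 ∧ ∀ y ∈ P, ⟪y - x, N x⟫ ≤ 0)
    (F : Euc n → Euc n)
    (hFint : IntegrableOn (fun x => ⟪F x, N x⟫) (frontier P) μH[(n : ℝ) - 1])
    (hF : ∀ φ ∈ G, ∀ x ∈ P, φ x ∈ P → F (φ x) = A φ (F x)) :
    ∫ x in frontier P, ⟪F x, N x⟫ ∂(μH[(n : ℝ) - 1]) = 0 := by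
  classical
  have hPc := hP.isCompact_s13
  have hPi := hP.interior_nonempty_s13
  have hPm : MeasurableSet P := hPc.isClosed.measurableSet
  have hfrm : MeasurableSet (frontier P) := isClosed_frontier.measurableSet
  have hfrP : frontier P ⊆ P := hPc.isClosed.frontier_subset
  set f : Euc n → ℝ := fun x => ⟪F x, N x⟫ with hf
  have hgood : ∀ᵐ x ∂(μH[(n : ℝ) - 1] : Measure (Euc n)), x ∈ frontier P →
      ∀ u, IsUnitNormal P x u → N x = u := by
    filter_upwards [(ae_restrict_iff' hfrm).1 hN, hP.ae_isUnitNormal_unique] with x h1 h2 hx u hu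
    exact h2 (hfrP hx) _ _ (h1 hx) hu
  -- The flux densities on two matching pieces of the boundary are opposite.
  have hneg : ∀ φ ∈ G, φ ≠ 1 → ∀ᵐ x ∂(μH[(n : ℝ) - 1] : Measure (Euc n)),
      x ∈ P → φ x ∈ P → f (φ x) = -f x := by
    intro φ hφ h1
    filter_upwards [hgood, (φ.measurePreserving_hausdorffMeasure
      ((n : ℝ) - 1)).quasiMeasurePreserving.ae hgood] with x hx1 hx2 hx hφx
    obtain ⟨u, hu, hu'⟩ := hT.exists_separating_normal hP.convex hPi hφ h1 hx hφx
    have hfr := hT.mem_frontier hφ h1 hx hφx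
    have hfr' : φ x ∈ frontier P := hT.mem_frontier (G.inv_mem hφ) (by simpa using h1) hφx
      (by simpa using hx)
    have hNx : N x = -(A φ).symm u := by
      refine hx1 hfr _ ⟨by simpa using hu.1, fun y hy => ?_⟩
      have h2 := hu' y hy
      rw [hA φ hφ y, hA φ hφ x, add_sub_add_right_eq_sub, ← map_sub] at h2
      rw [inner_neg_right, ← (A φ).inner_map_map, LinearIsometryEquiv.apply_symm_apply]
      linarith
    simp only [hf]
    rw [hx2 hfr' u hu, hNx, hF φ hφ x hx hφx, inner_neg_right, neg_neg,
      ← (A φ).inner_map_map (F x), LinearIsometryEquiv.apply_symm_apply]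
  have hfin := hT.finite_meeting hPc hPi hPc.isBounded
  set T := hfin.toFinset with hTdef
  have hTmem : ∀ φ, φ ∈ T ↔ φ ∈ G ∧ ∃ x ∈ P, φ x ∈ P := fun φ => by simp [hTdef]
  set S := T.erase 1 with hS
  have hSmem : ∀ φ, φ ∈ S ↔ φ ≠ 1 ∧ φ ∈ G ∧ ∃ x ∈ P, φ x ∈ P := fun φ => by
    rw [hS, Finset.mem_erase, hTmem]
  -- The number of other tiles containing a point.
  let m : Euc n → ℕ := fun x => (S.filter (fun φ => φ x ∈ P)).card
  have hmT : ∀ x ∈ P, m x + 1 = (T.filter (fun φ => φ x ∈ P)).card := by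
    intro x hx
    have h1 : (1 : Euc n ≃ᵢ Euc n) ∈ T.filter (fun φ => φ x ∈ P) :=
      Finset.mem_filter.2 ⟨(hTmem 1).2 ⟨G.one_mem, x, hx, by simpa using hx⟩, by simpa using hx⟩
    rw [← Finset.card_erase_add_one h1, ← Finset.filter_erase]
  have hminv : ∀ φ ∈ G, ∀ x ∈ P, φ x ∈ P → m (φ x) = m x := by
    intro φ hφ x hx hφx
    have h : (T.filter (fun ψ => ψ (φ x) ∈ P)).card = (T.filter (fun ψ => ψ x ∈ P)).card := by
      refine Finset.card_nbij' (fun ψ => ψ * φ) (fun ψ => ψ * φ⁻¹) ?_ ?_ ?_ ?_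
      · intro ψ hψ
        simp only [Finset.coe_filter, mem_ofPred_eq, hTmem] at hψ ⊢
        exact ⟨⟨G.mul_mem hψ.1.1 hφ, x, hx, hψ.2⟩, hψ.2⟩
      · intro ψ hψ
        simp only [Finset.coe_filter, mem_ofPred_eq, hTmem] at hψ ⊢
        have h2 : (ψ * φ⁻¹) (φ x) ∈ P := by simpa [IsometryEquiv.mul_apply] using hψ.2
        exact ⟨⟨G.mul_mem hψ.1.1 (G.inv_mem hφ), φ x, hφx, h2⟩, h2⟩
      · intro ψ _
        simp
      · intro ψ _
        simp
    have h1 := hmT x hx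
    have h2 := hmT _ hφx
    omega
  have hmpos : ∀ x ∈ frontier P, m x ≠ 0 := by
    intro x hx
    obtain ⟨φ, hφ, h1, hφx⟩ := hT.exists_ne_one_mem hPc hPi hx
    exact Finset.card_ne_zero_of_mem
      (Finset.mem_filter.2 ⟨(hSmem φ).2 ⟨h1, hφ, x, hfrP hx, hφx⟩, hφx⟩)
  let E : (Euc n ≃ᵢ Euc n) → Set (Euc n) := fun φ => P ∩ ⇑φ ⁻¹' P
  have hEm : ∀ φ, MeasurableSet (E φ) := fun φ =>
    hPm.inter (φ.continuous.measurable hPm)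
  have hmm : Measurable fun x => ((m x : ℝ))⁻¹ := by
    refine Measurable.inv ?_
    have : (fun x => (m x : ℝ)) = fun x => ∑ φ ∈ S, (⇑φ ⁻¹' P).indicator (fun _ => (1 : ℝ)) x := by
      funext x
      simp only [m, Finset.card_filter, indicator_apply, mem_preimage]
      push_cast
      rfl
    rw [this]
    exact Finset.measurable_sum _ fun φ _ =>
      measurable_const.indicator (φ.continuous.measurable hPm)
  let g : Euc n → ℝ := fun x => ((m x : ℝ))⁻¹ * f x
  have hgint : IntegrableOn g (frontier P) μH[(n : ℝ) - 1] := by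
    refine Integrable.bdd_mul (c := 1) hFint hmm.aestronglyMeasurable
      (Eventually.of_forall fun x => ?_)
    rw [Real.norm_eq_abs, abs_of_nonneg (by positivity)]
    exact Nat.cast_inv_le_one _
  have hdecomp : ∫ x in frontier P, f x ∂μH[(n : ℝ) - 1] =
      ∑ φ ∈ S, ∫ x in E φ, g x ∂μH[(n : ℝ) - 1] := by
    have hEfr : ∀ φ ∈ S, E φ ⊆ frontier P := fun φ hφ x hx =>
      hT.mem_frontier ((hSmem φ).1 hφ).2.1 ((hSmem φ).1 hφ).1 hx.1 hx.2
    have h1 : ∀ x ∈ frontier P, f x = ∑ φ ∈ S, (E φ).indicator g x := by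
      intro x hx
      have h2 : ∀ φ ∈ S, (E φ).indicator g x = if φ x ∈ P then g x else 0 := by
        intro φ _
        simp [indicator_apply, E, hfrP hx]
      rw [Finset.sum_congr rfl h2, ← Finset.sum_filter, Finset.sum_const, nsmul_eq_mul]
      simp only [g]
      rw [mul_inv_cancel_left₀]
      exact Nat.cast_ne_zero.2 (hmpos x hx)
    rw [setIntegral_congr_fun hfrm h1, integral_finsetSum]
    · refine Finset.sum_congr rfl fun φ hφ => ?_
      rw [setIntegral_indicator (hEm φ), inter_eq_self_of_subset_right (hEfr φ hφ)]
    · exact fun φ _ => hgint.indicator (hEm φ)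
  have hflip : ∀ φ ∈ S, ∫ x in E φ⁻¹, g x ∂μH[(n : ℝ) - 1] =
      -∫ x in E φ, g x ∂μH[(n : ℝ) - 1] := by
    intro φ hφS
    obtain ⟨h1, hφ, -⟩ := (hSmem φ).1 hφS
    have himg : E φ⁻¹ = ⇑φ '' E φ := by
      ext y
      constructor
      · rintro ⟨hy1, hy2⟩
        exact ⟨φ⁻¹ y, ⟨hy2, by simpa using hy1⟩, by simp⟩
      · rintro ⟨x, ⟨hx1, hx2⟩, rfl⟩
        exact ⟨hx2, by simpa using hx1⟩
    rw [himg, (φ.measurePreserving_hausdorffMeasure _).setIntegral_image_emb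
      φ.toHomeomorph.measurableEmbedding, ← integral_neg]
    refine setIntegral_congr_ae (hEm φ) ?_
    filter_upwards [hneg φ hφ h1] with x hx hxE
    simp only [g]
    rw [hminv φ hφ x hxE.1 hxE.2, hx hxE.1 hxE.2, mul_neg]
  have hinvS : ∀ φ ∈ S, φ⁻¹ ∈ S := by
    intro φ hφ
    obtain ⟨h1, hφ, x, hx, hφx⟩ := (hSmem φ).1 hφ
    exact (hSmem _).2 ⟨by simpa using h1, G.inv_mem hφ, φ x, hφx, by simpa using hx⟩
  have hsymm : ∑ φ ∈ S, ∫ x in E φ, g x ∂μH[(n : ℝ) - 1] =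
      ∑ φ ∈ S, ∫ x in E φ⁻¹, g x ∂μH[(n : ℝ) - 1] :=
    Finset.sum_nbij' (fun φ => φ⁻¹) (fun φ => φ⁻¹) hinvS hinvS (fun φ _ => inv_inv φ)
      (fun φ _ => inv_inv φ) fun φ _ => by rw [inv_inv]
  rw [Finset.sum_congr rfl hflip, Finset.sum_neg_distrib] at hsymm
  rw [hdecomp]
  linarith
end
end
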